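/- The 0-1 principle: Let n be a positive integer and let N be a finite sequence of ordered pairs of distinct indices in Fin n (a comparison network); for any linearly ordered type α, N induces a map on vectors x : Fin n → α by applying, in sequence, the compare-exchange operation for each pair (i,j), which replaces the pair of values (x i, x j) by (min(x i, x j), max(x i, x j)). Then the induced map of N sorts every input vector (i.e., its output is monotonically nondecreasing in the index) for every linearly ordered type α if and only if it sorts every Boolean input vector, where Bool is ordered with false < true. -/

import Mathlib

namespace ZeroOne

/-- The compare-exchange operation on the pair of wires `p = (i, j)`:
the values at positions `i` and `j` are replaced by their min at `i`
and their max at `j`. -/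
def cmpExch {α : Type*} [LinearOrder α] {n : ℕ} (p : Fin n × Fin n) (x : Fin n → α) :
    Fin n → α :=
  fun k => if k = p.1 then min (x p.1) (x p.2)
           else if k = p.2 then max (x p.1) (x p.2) else x k

/-- The map on vectors induced by a comparison network, i.e. a finite sequence of
ordered pairs of indices: apply the compare-exchange operations in sequence. -/
def runNetwork {α : Type*} [LinearOrder α] {n : ℕ} (N : List (Fin n × Fin n))
    (x : Fin n → α) : Fin n → α :=
  N.foldl (fun y p => cmpExch p y) x

theorem cmpExch_comp_monotone {α β : Type*} [LinearOrder α] [LinearOrder β] {n : ℕ}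
    {f : α → β} (hf : Monotone f) (p : Fin n × Fin n) (x : Fin n → α) :
    cmpExch p (f ∘ x) = f ∘ cmpExch p x := by
  funext k
  simp only [cmpExch, Function.comp_apply]
  split_ifs
  · exact hf.map_min.symm
  · exact hf.map_max.symm
  · rfl

/-- A comparison network commutes with applying a monotone map to every wire. -/
theorem runNetwork_comp_monotone {α β : Type*} [LinearOrder α] [LinearOrder β] {n : ℕ}
    {f : α → β} (hf : Monotone f) (N : List (Fin n × Fin n)) (x : Fin n → α) :
    runNetwork N (f ∘ x) = f ∘ runNetwork N x := by
  induction N generalizing x with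
  | nil => rfl
  | cons p N ih =>
    change runNetwork N (cmpExch p (f ∘ x)) = f ∘ runNetwork N (cmpExch p x)
    rw [cmpExch_comp_monotone hf, ih]

/-- **The 0-1 principle.**  A comparison network on `n` wires (a finite sequence of
ordered pairs of distinct indices) sorts every input vector over every linearly
ordered type if and only if it sorts every Boolean input vector. -/
theorem zero_one_principle.{u} {n : ℕ} (hn : 0 < n) (N : List (Fin n × Fin n))
    (hN : ∀ p ∈ N, p.1 ≠ p.2) :
    (∀ (α : Type u) (_ : LinearOrder α) (x : Fin n → α), Monotone (runNetwork N x)) ↔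
      (∀ x : Fin n → Bool, Monotone (runNetwork N x)) := by
  constructor
  · intro h x
    have hdown : Monotone (ULift.down : ULift.{u} Bool → Bool) := fun _ _ hab => hab
    have hx := runNetwork_comp_monotone hdown N (fun i => ULift.up (x i))
    exact hx ▸ hdown.comp (h (ULift.{u} Bool) inferInstance fun i => ULift.up (x i))
  · intro h α _ x i j hij
    by_contra! hlt
    have hf : Monotone fun a => decide (runNetwork N x j < a) := fun a b hab => by
      simpa [Bool.le_iff_imp] using fun ha => lt_of_lt_of_le ha hab
    have hmono := h ((fun a => decide (runNetwork N x j < a)) ∘ x) hij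
    rw [runNetwork_comp_monotone hf] at hmono
    simp [hlt, Bool.le_iff_imp] at hmono

end ZeroOne
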